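/- Fix a layer i (approvals may be asymmetric). There are at most three distinct matchings on the agent set A that are super stable in layer i. -/

import Mathlib

variable {A : Type*}

/-- A matching given by a partial partner function: symmetric and irreflexive. -/
def IsMatching (M : A → Option A) : Prop :=
  (∀ a b : A, M a = some b → M b = some a) ∧ ∀ a : A, M a ≠ some a

/-- Agent `a` is happy in layer `i`: matched to an agent it approves. -/
def Happy {ℓ : ℕ} (T : A → Fin ℓ → Set A) (M : A → Option A) (i : Fin ℓ) (a : A) : Prop :=
  ∃ b, M a = some b ∧ b ∈ T a i

/-- `{a, a'} ∉ M` blocks `M` in layer `i` under weak stability. -/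
def BlocksWeak {ℓ : ℕ} (T : A → Fin ℓ → Set A) (M : A → Option A) (i : Fin ℓ)
    (a a' : A) : Prop :=
  a ≠ a' ∧ M a ≠ some a' ∧ a' ∈ T a i ∧ a ∈ T a' i ∧
    ¬ Happy T M i a ∧ ¬ Happy T M i a'

/-- `{a, a'} ∉ M` blocks `M` in layer `i` under strong stability. -/
def BlocksStrong {ℓ : ℕ} (T : A → Fin ℓ → Set A) (M : A → Option A) (i : Fin ℓ)
    (a a' : A) : Prop :=
  a ≠ a' ∧ M a ≠ some a' ∧
    ((a' ∈ T a i ∧ ¬ Happy T M i a ∧ (a ∈ T a' i ∨ ¬ Happy T M i a')) ∨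
     (a ∈ T a' i ∧ ¬ Happy T M i a' ∧ (a' ∈ T a i ∨ ¬ Happy T M i a)))

/-- `{a, a'} ∉ M` blocks `M` in layer `i` under super stability. -/
def BlocksSuper {ℓ : ℕ} (T : A → Fin ℓ → Set A) (M : A → Option A) (i : Fin ℓ)
    (a a' : A) : Prop :=
  a ≠ a' ∧ M a ≠ some a' ∧ (a' ∈ T a i ∨ ¬ Happy T M i a) ∧
    (a ∈ T a' i ∨ ¬ Happy T M i a')

def WeakStable {ℓ : ℕ} (T : A → Fin ℓ → Set A) (M : A → Option A) (i : Fin ℓ) : Prop :=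
  ∀ a a' : A, ¬ BlocksWeak T M i a a'

def StrongStable {ℓ : ℕ} (T : A → Fin ℓ → Set A) (M : A → Option A) (i : Fin ℓ) : Prop :=
  ∀ a a' : A, ¬ BlocksStrong T M i a a'

def SuperStable {ℓ : ℕ} (T : A → Fin ℓ → Set A) (M : A → Option A) (i : Fin ℓ) : Prop :=
  ∀ a a' : A, ¬ BlocksSuper T M i a a'

/-- Mutual approval forces being matched. -/
lemma superStable_mutual {ℓ : ℕ} (T : A → Fin ℓ → Set A) (i : Fin ℓ) (N : A → Option A)
    (hs : SuperStable T N i) (a b : A) (hab : a ≠ b) (h1 : b ∈ T a i) (h2 : a ∈ T b i) :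
    N a = some b := by
  by_contra h
  exact hs a b ⟨hab, h, Or.inl h1, Or.inl h2⟩

/-- If both partners of a pair of `M` are happy, every super stable matching contains it. -/
lemma superStable_of_happy {ℓ : ℕ} (T : A → Fin ℓ → Set A) (i : Fin ℓ) (M N : A → Option A)
    (hM : IsMatching M) (hN : SuperStable T N i) (a b : A) (hab : M a = some b)
    (ha : Happy T M i a) (hb : Happy T M i b) : N a = some b := by
  have hba := hM.1 a b hab
  obtain ⟨x, hx, hxT⟩ := ha
  obtain ⟨y, hy, hyT⟩ := hb
  obtain rfl : b = x := by simpa [hab] using hx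
  obtain rfl : a = y := by simpa [hba] using hy
  exact superStable_mutual T i N hN a b (fun h => hM.2 a (h ▸ hab)) hxT hyT

lemma superStable_sub {ℓ : ℕ} (T : A → Fin ℓ → Set A) (i : Fin ℓ) (M N : A → Option A)
    (hM : IsMatching M) (hMs : SuperStable T M i) (hN : IsMatching N) (hNs : SuperStable T N i)
    (a b : A) (hab : M a = some b) : N a = some b := by
  have hba := hM.1 a b hab
  have hne : a ≠ b := fun h => hM.2 a (h ▸ hab)
  by_cases hh : Happy T M i a ∧ Happy T M i b
  · exact superStable_of_happy T i M N hM hNs a b hab hh.1 hh.2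
  by_contra hcon
  -- all other agents are happy in M
  have hoth : ∀ c, c ≠ a → c ≠ b → Happy T M i c := by
    intro c hca hcb
    by_contra hc
    by_cases ha : Happy T M i a
    · have hb : ¬ Happy T M i b := fun hb => hh ⟨ha, hb⟩
      refine hMs b c ⟨hcb.symm, ?_, Or.inr hb, Or.inr hc⟩
      rw [hba]
      intro h
      exact hca (Option.some.inj h).symm
    · refine hMs a c ⟨hca.symm, ?_, Or.inr ha, Or.inr hc⟩
      rw [hab]
      intro h
      exact hcb (Option.some.inj h).symm
  -- hence M and N agree on them
  have hagree : ∀ c, c ≠ a → c ≠ b → N c = M c := by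
    intro c hca hcb
    have hc := hoth c hca hcb
    obtain ⟨d, hd, -⟩ := id hc
    have hdc := hM.1 c d hd
    have hda : d ≠ a := by
      rintro rfl
      exact hcb (by simpa [hab] using hdc.symm)
    have hdb : d ≠ b := by
      rintro rfl
      exact hca (by simpa [hba] using hdc.symm)
    rw [hd]
    exact superStable_of_happy T i M N hM hNs c d hd hc (hoth d hda hdb)
  have hNa : N a = none := by
    rcases h : N a with _ | c
    · rfl
    · exfalso
      have hca : c ≠ a := fun e => hN.2 a (e ▸ h)
      have hcb : c ≠ b := fun e => hcon (e ▸ h)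
      have h1 := hM.1 c a ((hagree c hca hcb).symm.trans (hN.1 a c h))
      exact hcb (Option.some.inj (h1.symm.trans hab))
  have hNb : N b = none := by
    rcases h : N b with _ | c
    · rfl
    · exfalso
      have hcb : c ≠ b := fun e => hN.2 b (e ▸ h)
      have hca : c ≠ a := fun e => hcon (hN.1 b a (e ▸ h))
      have h1 := hM.1 c b ((hagree c hca hcb).symm.trans (hN.1 b c h))
      exact hca (Option.some.inj (h1.symm.trans hba))
  refine hNs a b ⟨hne, hcon, Or.inr ?_, Or.inr ?_⟩
  · rintro ⟨x, hx, -⟩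
    simp [hNa] at hx
  · rintro ⟨x, hx, -⟩
    simp [hNb] at hx

theorem at_most_three_superStable_matchings {ℓ : ℕ} [Fintype A] [DecidableEq A]
    (T : A → Fin ℓ → Set A) (hT : ∀ (a : A) (i : Fin ℓ), a ∉ T a i) (i : Fin ℓ) :
    Set.ncard {M : A → Option A | IsMatching M ∧ SuperStable T M i} ≤ 3 := by
  refine le_trans ((Set.ncard_le_one (Set.toFinite _)).2 ?_) (by norm_num)
  rintro M ⟨hM, hMs⟩ N ⟨hN, hNs⟩
  funext a
  apply Option.ext
  intro b
  exact ⟨superStable_sub T i M N hM hMs hN hNs a b, superStable_sub T i N M hN hNs hM hMs a b⟩
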